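/- Let u₁, u₂ : ℝ² → ℂ be smooth solutions of the second A₂⁽¹⁾-KdV flow, let k₁, k₂ ∈ ℂ, let h₁ be a smooth solution of (BT)_{(u₁,u₂),k₁} and h₂ a smooth solution of (BT)_{(u₁,u₂),k₂}, and assume h₁ − h₂ is nowhere zero on ℝ². Set h̃₁ := h₁ + ∂ₓ(h₁−h₂)/(h₁−h₂) and h̃₂ := h₂ + ∂ₓ(h₁−h₂)/(h₁−h₂). Then h̃₁∗(h₂∗(u₁,u₂)) = h̃₂∗(h₁∗(u₁,u₂)), i.e., both component functions of the two pairs agree on ℝ². -/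

import Mathlib

/-- Partial derivative in the first (space) variable. -/
noncomputable def px (f : ℝ × ℝ → ℂ) : ℝ × ℝ → ℂ :=
  fun p => deriv (fun x => f (x, p.2)) p.1

/-- Partial derivative in the second (time) variable. -/
noncomputable def pt (f : ℝ × ℝ → ℂ) : ℝ × ℝ → ℂ :=
  fun p => deriv (fun t => f (p.1, t)) p.2

/-- The second A₂⁽¹⁾-KdV flow. -/
def IsKdV2 (u₁ u₂ : ℝ × ℝ → ℂ) : Prop :=
  (∀ p, pt u₁ p = px (px u₁) p - (2/3 : ℂ) * px (px (px u₂)) p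
      + (2/3 : ℂ) * (u₂ p * px u₂ p)) ∧
  (∀ p, pt u₂ p = -(px (px u₂) p) + 2 * px u₁ p)

/-- The system (BT)_{(u₁,u₂),k}. -/
def IsBT (u₁ u₂ : ℝ × ℝ → ℂ) (k : ℂ) (h : ℝ × ℝ → ℂ) : Prop :=
  (∀ p, px (px h) p = -u₁ p + px u₂ p + h p * u₂ p - 3 * h p * px h p - (h p) ^ 3 - k) ∧
  (∀ p, pt h p = (2/3 : ℂ) * px u₂ p - px (px h) p - 2 * h p * px h p)

/-- The Bäcklund transformation `h ∗ (u₁, u₂)`. -/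
noncomputable def btStar (h u₁ u₂ : ℝ × ℝ → ℂ) : (ℝ × ℝ → ℂ) × (ℝ × ℝ → ℂ) :=
  (fun p => u₁ p - px u₂ p + 3 * h p * px h p, fun p => u₂ p - 3 * px h p)

theorem px_hasDerivAt {f : ℝ × ℝ → ℂ} (hf : ContDiff ℝ (⊤ : ℕ∞) f) (p : ℝ × ℝ) :
    HasDerivAt (fun x => f (x, p.2)) (px f p) p.1 := by
  have hd : Differentiable ℝ f := hf.differentiable (by simp)
  have h : DifferentiableAt ℝ (fun x : ℝ => f (x, p.2)) p.1 := by fun_prop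
  exact h.hasDerivAt

theorem px_contDiff {f : ℝ × ℝ → ℂ} (hf : ContDiff ℝ (⊤ : ℕ∞) f) :
    ContDiff ℝ (⊤ : ℕ∞) (px f) := by
  have hd : Differentiable ℝ f := hf.differentiable (by simp)
  have h : px f = fun p => fderiv ℝ f p (1, 0) := by
    funext p
    have h1 : HasDerivAt (fun x : ℝ => (x, p.2)) ((1 : ℝ), (0 : ℝ)) p.1 :=
      (hasDerivAt_id p.1).prodMk (hasDerivAt_const p.1 p.2)
    have h2 : HasFDerivAt f (fderiv ℝ f p) (p.1, p.2) := (hd p).hasFDerivAt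
    exact (h2.comp_hasDerivAt p.1 h1).deriv
  rw [h]
  exact (hf.fderiv_right (m := (⊤ : ℕ∞)) (by simp)).clm_apply contDiff_const

/-- Permutability for Bäcklund transformations, part (ii):
`h̃₁ ∗ (h₂ ∗ u) = h̃₂ ∗ (h₁ ∗ u)`. -/
theorem stmt9 (u₁ u₂ h₁ h₂ : ℝ × ℝ → ℂ) (k₁ k₂ : ℂ)
    (hu₁ : ContDiff ℝ (⊤ : ℕ∞) u₁) (hu₂ : ContDiff ℝ (⊤ : ℕ∞) u₂)
    (hh₁ : ContDiff ℝ (⊤ : ℕ∞) h₁) (hh₂ : ContDiff ℝ (⊤ : ℕ∞) h₂)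
    (hKdV : IsKdV2 u₁ u₂)
    (hBT₁ : IsBT u₁ u₂ k₁ h₁) (hBT₂ : IsBT u₁ u₂ k₂ h₂)
    (hne : ∀ p, h₁ p - h₂ p ≠ 0)
    (ht₁ ht₂ : ℝ × ℝ → ℂ)
    (hht₁ : ∀ p, ht₁ p = h₁ p + px (fun q => h₁ q - h₂ q) p / (h₁ p - h₂ p))
    (hht₂ : ∀ p, ht₂ p = h₂ p + px (fun q => h₁ q - h₂ q) p / (h₁ p - h₂ p)) :
    (∀ p, (btStar ht₁ (btStar h₂ u₁ u₂).1 (btStar h₂ u₁ u₂).2).1 p =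
          (btStar ht₂ (btStar h₁ u₁ u₂).1 (btStar h₁ u₁ u₂).2).1 p) ∧
    (∀ p, (btStar ht₁ (btStar h₂ u₁ u₂).1 (btStar h₂ u₁ u₂).2).2 p =
          (btStar ht₂ (btStar h₁ u₁ u₂).1 (btStar h₁ u₁ u₂).2).2 p) := by
  have hd : px (fun q => h₁ q - h₂ q) = fun p => px h₁ p - px h₂ p := by
    funext p
    exact ((px_hasDerivAt hh₁ p).sub (px_hasDerivAt hh₂ p)).deriv
  rw [hd] at hht₁ hht₂
  have e₁ : ht₁ = fun p => h₁ p + (px h₁ p - px h₂ p) / (h₁ p - h₂ p) := funext hht₁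
  have e₂ : ht₂ = fun p => h₂ p + (px h₁ p - px h₂ p) / (h₁ p - h₂ p) := funext hht₂
  have hw : ∀ p, HasDerivAt
      (fun x => (px h₁ (x, p.2) - px h₂ (x, p.2)) / (h₁ (x, p.2) - h₂ (x, p.2)))
      (((px (px h₁) p - px (px h₂) p) * (h₁ p - h₂ p)
        - (px h₁ p - px h₂ p) * (px h₁ p - px h₂ p)) / (h₁ p - h₂ p) ^ 2) p.1 := fun p =>
    ((px_hasDerivAt (px_contDiff hh₁) p).sub (px_hasDerivAt (px_contDiff hh₂) p)).div
      ((px_hasDerivAt hh₁ p).sub (px_hasDerivAt hh₂ p)) (hne p)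
  have d₁ : ∀ p, px ht₁ p = px h₁ p + ((px (px h₁) p - px (px h₂) p) * (h₁ p - h₂ p)
        - (px h₁ p - px h₂ p) * (px h₁ p - px h₂ p)) / (h₁ p - h₂ p) ^ 2 := by
    intro p
    rw [e₁]
    exact ((px_hasDerivAt hh₁ p).add (hw p)).deriv
  have d₂ : ∀ p, px ht₂ p = px h₂ p + ((px (px h₁) p - px (px h₂) p) * (h₁ p - h₂ p)
        - (px h₁ p - px h₂ p) * (px h₁ p - px h₂ p)) / (h₁ p - h₂ p) ^ 2 := by
    intro p
    rw [e₂]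
    exact ((px_hasDerivAt hh₂ p).add (hw p)).deriv
  have hv : ∀ h : ℝ × ℝ → ℂ, ContDiff ℝ (⊤ : ℕ∞) h → ∀ p,
      px (fun p => u₂ p - 3 * px h p) p = px u₂ p - 3 * px (px h) p := fun h hh p =>
    ((px_hasDerivAt hu₂ p).sub ((px_hasDerivAt (px_contDiff hh) p).const_mul 3)).deriv
  refine ⟨fun p => ?_, fun p => ?_⟩
  · simp only [btStar]
    rw [hv h₁ hh₁, hv h₂ hh₂, d₁, d₂, hht₁, hht₂]
    have := hne p
    field_simp
    ring
  · simp only [btStar]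
    rw [d₁, d₂]
    ring
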